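/- Let G be a finite non-abelian quaternion-free 2-group. Then G has a characteristic subgroup of index 2. -/

import Mathlib

/-- A group is quaternion-free if no section (quotient of a subgroup) is
isomorphic to the quaternion group `Q₈`; equivalently, no subgroup maps
onto `Q₈`. -/
def QuaternionFree (G : Type*) [Group G] : Prop :=
  ∀ (H : Subgroup G) (f : H →* QuaternionGroup 2), ¬ Function.Surjective f
namespace WardQF

open scoped commutatorElement

open QuaternionGroup in
/-- A quaternion-free group has no pair of elements satisfying the relations of `Q₈`. -/
theorem qf_no_q8 {G : Type*} [Group G] (h : QuaternionFree G) (x y : G) (hxy : y * y = x ^ 2)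
    (hc : x * y = y * x⁻¹) (h1 : x ^ 2 ≠ 1) : False := by
  have e4 : x ^ 4 = 1 := by
    have h3 : x ^ 2 * y = y * x ^ 2 := by rw [← hxy]; group
    have h4 : x ^ 2 * y = y * (x⁻¹) ^ 2 := by
      rw [pow_two, mul_assoc, hc, ← mul_assoc, hc]; group
    have h5 := mul_left_cancel (h3.symm.trans h4)
    calc x ^ 4 = x ^ 2 * x ^ 2 := by group
      _ = 1 := by nth_rw 1 [h5]; group
  have hi : x⁻¹ = x ^ 3 := by
    rw [inv_eq_iff_mul_eq_one, ← pow_succ', e4]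
  have hm : ∀ n : ℕ, x ^ n * y = y * x ^ (3 * n) := by
    intro n
    induction n with
    | zero => simp
    | succ n ih =>
      rw [pow_succ, mul_assoc, hc, ← mul_assoc, ih, hi, mul_assoc, ← pow_add]
      rfl
  have hmod : ∀ a b : ℕ, a % 4 = b % 4 → x ^ a = x ^ b := by
    intro a b hab
    rw [← Nat.div_add_mod a 4, ← Nat.div_add_mod b 4, pow_add, pow_add, pow_mul, pow_mul, e4, hab]
    simp
  let g : QuaternionGroup 2 →* G := MonoidHom.mk' (fun q => match q with
    | a i => x ^ (ZMod.val i)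
    | xa i => y * x ^ (ZMod.val i)) (by
      rintro (i | i) (j | j)
      · simp only [a_mul_a, ← pow_add]
        apply hmod; revert i j; decide
      · simp only [a_mul_xa, ← mul_assoc, hm]
        simp only [mul_assoc, ← pow_add]
        congr 1
        apply hmod; revert i j; decide
      · simp only [xa_mul_a, mul_assoc, ← pow_add]
        congr 1
        apply hmod; revert i j; decide
      · simp only [xa_mul_xa]
        rw [mul_assoc, ← mul_assoc (x ^ _) y, hm, mul_assoc, ← mul_assoc y y, hxy,
          ← pow_add, ← pow_add]
        apply hmod; revert i j; decide)
  have hone : x ≠ 1 := by rintro rfl; simp at h1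
  have h3 : x ^ 3 ≠ 1 := by
    intro h3
    apply hone
    have : x ^ 4 = x ^ 3 * x := pow_succ x 3
    rw [e4, h3, one_mul] at this
    exact this.symm
  have hyx : ∀ n : ℕ, y * x ^ n ≠ 1 := by
    intro n hn
    apply h1
    have : y = (x ^ n)⁻¹ := eq_inv_of_mul_eq_one_left hn
    have h6 : x * y = y * x := by rw [this]; group
    have := mul_left_cancel (hc.symm.trans h6)
    rw [pow_two]; nth_rw 1 [← this]; group
  have hg : Function.Injective g := by
    rw [injective_iff_map_eq_one]
    rintro (i | i) hi
    · change x ^ (ZMod.val i) = 1 at hi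
      rw [one_def]
      congr 1
      change ZMod 4 at i
      fin_cases i
      · rfl
      · exact absurd ((pow_one x).symm.trans hi) hone
      · exact absurd hi h1
      · exact absurd hi h3
    · exact absurd hi (hyx _)
  exact h g.range (MonoidHom.ofInjective hg).symm.toMonoidHom (MulEquiv.surjective _)

theorem qf_quotient {G : Type*} [Group G] (h : QuaternionFree G) (N : Subgroup G) [N.Normal] :
    QuaternionFree (G ⧸ N) := by
  intro H f hf
  refine h (H.comap (QuotientGroup.mk' N))
    (f.comp ((QuotientGroup.mk' N).subgroupComap H)) ?_
  rw [MonoidHom.coe_comp]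
  refine hf.comp ?_
  exact MonoidHom.subgroupComap_surjective_of_surjective _ _ (QuotientGroup.mk'_surjective N)

section basic
variable {G : Type*} [Group G]

theorem comm_formula (x y : G) (hsq : ∀ a b : G, a ^ 2 * b = b * a ^ 2) :
    ⁅x, y⁆ = (x * y) ^ 2 * (x⁻¹) ^ 2 * (y⁻¹) ^ 2 := by
  rw [pow_two y⁻¹, mul_assoc, ← mul_assoc (x⁻¹ ^ 2), hsq x⁻¹, commutatorElement_def]
  simp only [pow_two]
  group

theorem comm_central (hsq : ∀ a b : G, a ^ 2 * b = b * a ^ 2) (x y z : G) :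
    ⁅x, y⁆ * z = z * ⁅x, y⁆ := by
  rw [comm_formula x y hsq]
  rw [mul_assoc, hsq _ z, ← mul_assoc, mul_assoc _ _ z, hsq _ z, ← mul_assoc, hsq _ z]
  simp only [mul_assoc]

theorem mul_comm_comm (x y : G) : x * y = ⁅x, y⁆ * (y * x) := by
  rw [commutatorElement_def]; group

theorem comm_mul_left (hsq : ∀ a b : G, a ^ 2 * b = b * a ^ 2) (x y z : G) :
    ⁅x * y, z⁆ = ⁅x, z⁆ * ⁅y, z⁆ := by
  have : ⁅x * y, z⁆ = x * ⁅y, z⁆ * x⁻¹ * ⁅x, z⁆ := by simp only [commutatorElement_def]; group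
  rw [this, ← comm_central hsq y z x, mul_assoc _ x, mul_inv_cancel, mul_one, comm_central hsq]

theorem comm_sq (hsq : ∀ a b : G, a ^ 2 * b = b * a ^ 2) (x y : G) : ⁅x, y⁆ ^ 2 = 1 := by
  rw [pow_two, ← comm_mul_left hsq, ← pow_two, commutatorElement_eq_one_iff_mul_comm, hsq]

theorem comm_symm (hsq : ∀ a b : G, a ^ 2 * b = b * a ^ 2) (x y : G) : ⁅x, y⁆ = ⁅y, x⁆ := by
  have := comm_sq hsq x y
  rw [pow_two] at this
  rw [← commutatorElement_inv x y]
  exact eq_inv_of_mul_eq_one_left this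

theorem comm_mul_right (hsq : ∀ a b : G, a ^ 2 * b = b * a ^ 2) (x y z : G) :
    ⁅x, y * z⁆ = ⁅x, y⁆ * ⁅x, z⁆ := by
  rw [comm_symm hsq, comm_mul_left hsq, comm_symm hsq y, comm_symm hsq z]

theorem mul_sq (hsq : ∀ a b : G, a ^ 2 * b = b * a ^ 2) (x y : G) :
    (x * y) ^ 2 = x ^ 2 * y ^ 2 * ⁅x, y⁆ := by
  rw [comm_symm hsq, ← comm_central hsq]
  have : (x * y) ^ 2 = x * (y * x) * y := by rw [pow_two]; group
  rw [this, mul_comm_comm y x, ← mul_assoc, ← comm_central hsq]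
  simp only [pow_two, mul_assoc]

theorem even_central (hsq : ∀ a b : G, a ^ 2 * b = b * a ^ 2) (x y : G) (i : ℤ) (hi : Even i) :
    x ^ i * y = y * x ^ i := by
  obtain ⟨k, rfl⟩ := hi
  have : x ^ (k + k) = (x ^ k) ^ 2 := by rw [pow_two, zpow_add]
  rw [this, hsq]

theorem mul_pow_four (hsq : ∀ a b : G, a ^ 2 * b = b * a ^ 2) (x y : G) (m : ℕ) (hm : 2 ≤ m) :
    (x * y) ^ 2 ^ m = x ^ 2 ^ m * y ^ 2 ^ m := by
  obtain ⟨k, rfl⟩ := Nat.exists_eq_add_of_le hm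
  have h4 : (x * y) ^ 4 = x ^ 4 * y ^ 4 := by
    have : (x * y) ^ 4 = ((x * y) ^ 2) ^ 2 := by group
    rw [this, mul_sq hsq, (Commute.mul_pow (comm_central hsq x y _).symm), comm_sq hsq, mul_one,
      Commute.mul_pow (hsq _ _)]
    group
  rw [pow_add, pow_mul, pow_mul, pow_mul]
  norm_num
  rw [h4, Commute.mul_pow]
  have : x ^ 4 = (x ^ 2) ^ 2 := by group
  change x ^ 4 * _ = _ * x ^ 4
  rw [this, hsq]

theorem comm_zpow (hsq : ∀ a b : G, a ^ 2 * b = b * a ^ 2) (x y : G) (i j : ℤ) :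
    ⁅x ^ i, y ^ j⁆ = ⁅x, y⁆ ^ (i * j) := by
  have h1 : ∀ (x y : G) (i : ℤ), ⁅x ^ i, y⁆ = ⁅x, y⁆ ^ i := by
    intro x y i
    exact map_zpow (MonoidHom.mk' (fun x => ⁅x, y⁆) (fun a b => comm_mul_left hsq a b y)) x i
  rw [h1, comm_symm hsq, h1, comm_symm hsq, ← zpow_mul, mul_comm]

theorem zpow_sq_one {c : G} (hc : c ^ 2 = 1) (i : ℤ) :
    (Even i → c ^ i = 1) ∧ (Odd i → c ^ i = c) := by
  have hz : c ^ (2 : ℤ) = 1 := by exact_mod_cast hc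
  constructor
  · rintro ⟨k, rfl⟩
    rw [← two_mul, zpow_mul, hz, one_zpow]
  · rintro ⟨k, rfl⟩
    rw [zpow_add, zpow_mul, hz, one_zpow, one_mul, zpow_one]

/-- The key consequence of quaternion-freeness. -/
theorem key (hsq : ∀ a b : G, a ^ 2 * b = b * a ^ 2) (h : QuaternionFree G) (x y : G) :
    (∃ i j : ℤ, ⁅x, y⁆ = x ^ (4 * i) * y ^ (4 * j)) ∨
    (∃ i j : ℤ, ¬ (Even i ∧ Even j) ∧ (x ^ i * y ^ j) ^ 2 = 1) := by
  set c := ⁅x, y⁆ with hcdef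
  have hcc : ∀ z, c * z = z * c := comm_central hsq x y
  have hc2 : c ^ 2 = 1 := comm_sq hsq x y
  have hu : ∀ z, (x ^ 2 * c) * z = z * (x ^ 2 * c) := by
    intro z; rw [mul_assoc, hcc, ← mul_assoc, hsq, mul_assoc]
  have hv : ∀ z, (y ^ 2 * c) * z = z * (y ^ 2 * c) := by
    intro z; rw [mul_assoc, hcc, ← mul_assoc, hsq, mul_assoc]
  have hn : ∀ u : G, (∀ z, u * z = z * u) → (Subgroup.zpowers u).Normal := by
    intro u hu
    refine ⟨fun n hn g => ?_⟩
    obtain ⟨k, rfl⟩ := hn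
    have : u ^ k * g = g * u ^ k := Commute.zpow_left (hu g) k
    simp only []
    rw [← this, mul_assoc, mul_inv_cancel, mul_one]
    exact ⟨k, rfl⟩
  have := hn _ hu
  have := hn _ hv
  set N := Subgroup.zpowers (x ^ 2 * c) ⊔ Subgroup.zpowers (y ^ 2 * c) with hN
  have : N.Normal := Subgroup.sup_normal _ _
  have hcN : c ∈ N := by
    by_contra hcN
    have e1 : (QuotientGroup.mk' N x) ^ 2 * QuotientGroup.mk' N c = 1 := by
      rw [← map_pow, ← map_mul, ← MonoidHom.mem_ker, QuotientGroup.ker_mk']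
      exact Subgroup.mem_sup_left (Subgroup.mem_zpowers _)
    have e2 : (QuotientGroup.mk' N y) ^ 2 * QuotientGroup.mk' N c = 1 := by
      rw [← map_pow, ← map_mul, ← MonoidHom.mem_ker, QuotientGroup.ker_mk']
      exact Subgroup.mem_sup_right (Subgroup.mem_zpowers _)
    have e3 : QuotientGroup.mk' N c ≠ 1 := by
      rw [Ne, ← MonoidHom.mem_ker, QuotientGroup.ker_mk']
      exact hcN
    have e4 : (QuotientGroup.mk' N c) ^ 2 = 1 := by rw [← map_pow, hc2, map_one]
    have e5 := congrArg (QuotientGroup.mk' N) (mul_comm_comm x y)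
    have e6 := congrArg (QuotientGroup.mk' N) (hcc (y * x))
    rw [← hcdef] at e5
    simp only [map_mul] at e5 e6
    generalize QuotientGroup.mk' N x = X at *
    generalize QuotientGroup.mk' N y = Y at *
    generalize QuotientGroup.mk' N c = C at *
    have hX : X ^ 2 = C := by
      rw [eq_inv_of_mul_eq_one_left e1, inv_eq_iff_mul_eq_one, ← pow_two, e4]
    have hY : Y ^ 2 = C := by
      rw [eq_inv_of_mul_eq_one_left e2, inv_eq_iff_mul_eq_one, ← pow_two, e4]
    refine qf_no_q8 (qf_quotient h N) X Y (by rw [← pow_two, hX, hY]) ?_ (by rw [hX]; exact e3)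
    rw [e5, e6, mul_assoc]
    congr 1
    rw [eq_inv_iff_mul_eq_one, ← hX]
    calc X * X ^ 2 * X = (X ^ 2) ^ 2 := by group
      _ = 1 := by rw [hX, e4]
  rw [hN, Subgroup.mem_sup_of_normal_left] at hcN
  obtain ⟨_, ⟨i, rfl⟩, _, ⟨j, rfl⟩, hij⟩ := hcN
  simp only [] at hij
  rw [Commute.mul_zpow (hcc _).symm, Commute.mul_zpow (hcc _).symm] at hij
  have hij' : x ^ (2 * i) * y ^ (2 * j) * c ^ (i + j) = c := by
    rw [zpow_mul, zpow_mul, zpow_add]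
    have h7 : c ^ i * (y ^ (2 : ℤ)) ^ j = (y ^ (2 : ℤ)) ^ j * c ^ i := Commute.zpow_left (hcc _) i
    have h8 : (y ^ (2 : ℕ)) = (y ^ (2 : ℤ)) := by norm_cast
    have h9 : (x ^ (2 : ℕ)) = (x ^ (2 : ℤ)) := by norm_cast
    rw [h8, h9] at hij
    refine Eq.trans ?_ hij
    rw [mul_assoc, mul_assoc, ← mul_assoc (c ^ i), h7]
    simp only [mul_assoc]
  have hsqij : (x ^ i * y ^ j) ^ 2 = x ^ (2 * i) * y ^ (2 * j) * c ^ (i * j) := by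
    rw [mul_sq hsq, comm_zpow hsq, ← zpow_natCast, ← zpow_natCast (y ^ j), ← zpow_mul, ← zpow_mul,
      mul_comm i, mul_comm j]
    push_cast
    rw [mul_comm i j, mul_comm j i]
  rcases Int.even_or_odd i with hi | hi <;> rcases Int.even_or_odd j with hj | hj
  · left
    rw [(zpow_sq_one hc2 _).1 (hi.add hj), mul_one] at hij'
    obtain ⟨k, rfl⟩ := hi
    obtain ⟨l, rfl⟩ := hj
    refine ⟨k, l, ?_⟩
    rw [← hij']
    congr 2 <;> ring
  · right
    refine ⟨i, j, by grind, ?_⟩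
    rw [(zpow_sq_one hc2 _).2 (hi.add_odd hj)] at hij'
    rw [hsqij, (zpow_sq_one hc2 _).1 (hi.mul_right _), mul_one]
    simpa using hij'
  · right
    refine ⟨i, j, by grind, ?_⟩
    rw [(zpow_sq_one hc2 _).2 (hi.add_even hj)] at hij'
    rw [hsqij, (zpow_sq_one hc2 _).1 (hj.mul_left _), mul_one]
    simpa using hij'
  · right
    refine ⟨i, j, by grind, ?_⟩
    rw [(zpow_sq_one hc2 _).1 (hi.add_odd hj), mul_one] at hij'
    rw [hsqij, (zpow_sq_one hc2 _).2 (hi.mul hj), hij', ← pow_two, hc2]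

/-- An automorphism-invariant predicate which behaves like the kernel of a
homomorphism onto a group of order two. -/
theorem char_of_pred (P : G → Prop) (hinv : ∀ (f : G ≃* G) g, P g → P (f g))
    (h1 : ∀ g h, P g → P h → P (g * h)) (h2 : ∀ g h, ¬ P g → ¬ P h → P (g * h))
    (h3 : ∃ g, ¬ P g) : ∃ H : Subgroup G, H.Characteristic ∧ H.index = 2 := by
  have hone : P 1 := by
    by_contra hc
    have := h2 1 1 hc hc
    rw [mul_one] at this
    exact hc this
  have hin : ∀ g, P g → P g⁻¹ := by
    intro g hg
    by_contra hc
    have := h1 _ _ hg (h2 _ _ hc hc)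
    rw [mul_inv_cancel_left] at this
    exact hc this
  let H : Subgroup G :=
    { carrier := {g | P g}
      mul_mem' := fun {a b} ha hb => h1 a b ha hb
      one_mem' := hone
      inv_mem' := fun {a} ha => hin a ha }
  have hmem : ∀ g, g ∈ H ↔ P g := fun g => Iff.rfl
  refine ⟨H, ?_, ?_⟩
  · rw [Subgroup.characteristic_iff_map_le]
    rintro f _ ⟨g, hg, rfl⟩
    exact hinv f g hg
  · rw [Subgroup.index_eq_two_iff]
    obtain ⟨a, ha⟩ := h3
    refine ⟨a, fun b => ?_⟩
    rw [hmem, hmem]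
    by_cases hb : P b
    · refine Or.inr ⟨hb, fun hba => ha ?_⟩
      have := h1 _ _ (hin _ hb) hba
      rwa [inv_mul_cancel_left] at this
    · exact Or.inl ⟨h2 _ _ hb ha, hb⟩

end basic
section cyclic
variable {G : Type*} [Group G]

theorem cyc_one (m : ℕ) : ∀ (g h : G), g ^ 2 ^ (m + 1) = 1 → h ∈ Subgroup.zpowers g → h ≠ 1 →
    g ^ 2 ^ m ∈ Subgroup.zpowers h := by
  induction m with
  | zero =>
    rintro g h hg ⟨a, rfl⟩ hne
    simp only [zero_add, pow_one] at hg
    rcases Int.even_or_odd a with ha | ha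
    · exact absurd ((zpow_sq_one hg a).1 ha) hne
    · simp only [(zpow_sq_one hg a).2 ha]
      simp
  | succ m ih =>
    rintro g h hg ⟨a, rfl⟩ hne
    rcases Int.even_or_odd a with ha | ha
    · have := ih (g ^ 2) (g ^ a) (by rw [← pow_mul, ← pow_succ']; exact hg) ?_ hne
      · rw [← pow_mul, ← pow_succ'] at this
        exact this
      · obtain ⟨k, rfl⟩ := ha
        refine ⟨k, ?_⟩
        simp only []
        rw [← zpow_natCast, ← zpow_mul, ← two_mul]
        rfl
    · refine ⟨(2 ^ (m + 1) : ℕ), ?_⟩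
      have hW : (g ^ 2 ^ (m + 1)) ^ 2 = 1 := by rw [← pow_mul, ← pow_succ]; exact hg
      have h1 := (zpow_sq_one hW a).2 ha
      simp only []
      rw [← zpow_mul, mul_comm, zpow_mul, zpow_natCast, h1]

theorem zpowers_sq_one {h w : G} (hh : h ^ 2 = 1) (hw : w ∈ Subgroup.zpowers h) :
    w = 1 ∨ w = h := by
  obtain ⟨a, rfl⟩ := hw
  rcases Int.even_or_odd a with ha | ha
  · exact Or.inl ((zpow_sq_one hh a).1 ha)
  · exact Or.inr ((zpow_sq_one hh a).2 ha)

theorem cyc_two (m : ℕ) (g h : G) (hg : g ^ 2 ^ (m + 1) = 1) (hW : g ^ 2 ^ m ≠ 1)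
    (hh : h ∈ Subgroup.zpowers g) (h2 : h ^ 2 = 1) : h = 1 ∨ h = g ^ 2 ^ m := by
  by_cases h1 : h = 1
  · exact Or.inl h1
  · right
    rcases zpowers_sq_one h2 (cyc_one m g h hg hh h1) with h3 | h3
    · exact absurd h3 hW
    · exact h3.symm

theorem disj (m k : ℕ) (x y : G) (hx : x ^ 2 ^ (m + 1) = 1) (hy : y ^ 2 ^ (k + 1) = 1)
    (hx1 : x ^ 2 ^ m ≠ 1) (hy1 : y ^ 2 ^ k ≠ 1) (hne : x ^ 2 ^ m ≠ y ^ 2 ^ k) (a b : ℤ)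
    (hab : x ^ a * y ^ b = 1) : x ^ a = 1 ∧ y ^ b = 1 := by
  have h1 : x ^ a = 1 := by
    by_contra hc
    have h2 := cyc_one m x (x ^ a) hx ⟨a, rfl⟩ hc
    have h3 : x ^ a ∈ Subgroup.zpowers y := by
      rw [eq_inv_of_mul_eq_one_left hab]
      exact inv_mem ⟨b, rfl⟩
    have h4 : x ^ 2 ^ m ∈ Subgroup.zpowers y := Subgroup.zpowers_le.2 h3 h2
    rcases cyc_two k y _ hy hy1 h4 (by rw [← pow_mul, ← pow_succ]; exact hx) with h5 | h5
    · exact hx1 h5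
    · exact hne h5
  rw [h1, one_mul] at hab
  exact ⟨h1, hab⟩

theorem disj' (hsq : ∀ a b : G, a ^ 2 * b = b * a ^ 2)
    (m k : ℕ) (x y : G) (hx : x ^ 2 ^ (m + 1) = 1) (hy : y ^ 2 ^ (k + 1) = 1)
    (hx1 : x ^ 2 ^ m ≠ 1) (hy1 : y ^ 2 ^ k ≠ 1) (hne : x ^ 2 ^ m ≠ y ^ 2 ^ k) (a b : ℤ)
    (ha : Even a) (hab : (x ^ a * y ^ b) ^ 2 = 1) :
    (x ^ a = 1 ∨ x ^ a = x ^ 2 ^ m) ∧ (y ^ b = 1 ∨ y ^ b = y ^ 2 ^ k) := by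
  rw [Commute.mul_pow (even_central hsq _ _ _ ha)] at hab
  have h1 : ∀ (x : G) (a : ℤ), (x ^ a) ^ 2 = x ^ (a * 2) := by
    intro x a
    rw [zpow_mul]; norm_cast
  rw [h1, h1] at hab
  have := disj m k x y hx hy hx1 hy1 hne _ _ hab
  rw [← h1, ← h1] at this
  exact ⟨cyc_two m _ _ hx hx1 ⟨a, rfl⟩ this.1, cyc_two k _ _ hy hy1 ⟨b, rfl⟩ this.2⟩

end cyclic

universe u

theorem exists_ring (A : Type u) [CommGroup A] (hA : ∀ a : A, a ^ 2 = 1) :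
    ∃ (R : Type u) (_ : CommRing R) (j : A → R), (2 : R) = 0 ∧
      (∀ a b, j (a * b) = j a + j b) ∧ Function.Injective j := by
  let _ : Module (ZMod 2) (Additive A) := AddCommGroup.zmodModule (n := 2) (by
    intro x
    exact hA x.toMul)
  let B := Module.Basis.ofVectorSpace (ZMod 2) (Additive A)
  refine ⟨Module.Basis.ofVectorSpaceIndex (ZMod 2) (Additive A) → ZMod 2, inferInstance,
    fun a => ⇑(B.repr (Additive.ofMul a)), ?_, ?_, ?_⟩
  · funext i
    change (2 : ZMod 2) = 0
    rfl
  · intro a b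
    simp
  · intro a b hab
    have : B.repr (Additive.ofMul a) = B.repr (Additive.ofMul b) := DFunLike.coe_injective hab
    exact Additive.ofMul.injective (B.repr.injective this)

/-- Elements which are central and square to one embed in a ring of characteristic two. -/
theorem exists_j (G : Type u) [Group G] :
    ∃ (R : Type u) (_ : CommRing R) (j : G → R), (2 : R) = 0 ∧
      (∀ a b : G, (∀ z, a * z = z * a) → a ^ 2 = 1 → (∀ z, b * z = z * b) → b ^ 2 = 1 →
        j (a * b) = j a + j b ∧ (j a = j b → a = b)) := by
  let A : Subgroup G :=
    { carrier := {a | (∀ z, a * z = z * a) ∧ a ^ 2 = 1}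
      mul_mem' := by
        rintro a b ⟨ha, ha2⟩ ⟨hb, hb2⟩
        refine ⟨fun z => ?_, ?_⟩
        · rw [mul_assoc, hb, ← mul_assoc, ha, mul_assoc]
        · rw [Commute.mul_pow (ha b), ha2, hb2, one_mul]
      one_mem' := by simp
      inv_mem' := by
        rintro a ⟨ha, ha2⟩
        refine ⟨fun z => ?_, by simp [ha2]⟩
        exact Commute.inv_left (ha z) }
  let _ : CommGroup A :=
    { (inferInstance : Group A) with
      mul_comm := fun a b => Subtype.ext (a.2.1 b) }
  obtain ⟨R, hR, j, h2, hj, hi⟩ := exists_ring A (by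
    rintro ⟨a, ha⟩
    exact Subtype.ext ha.2)
  classical
  have hm : ∀ a : G, ((∀ z, a * z = z * a) ∧ a ^ 2 = 1) → ∃ b : A, (b : G) = a := by
    rintro a ha
    exact ⟨⟨a, ha⟩, rfl⟩
  refine ⟨R, hR, fun a => if h : (∀ z, a * z = z * a) ∧ a ^ 2 = 1 then j (hm a h).choose else 0,
    h2, ?_⟩
  intro a b ha ha2 hb hb2
  have hab : (∀ z, a * b * z = z * (a * b)) ∧ (a * b) ^ 2 = 1 := by
    constructor
    · intro z
      rw [mul_assoc, hb, ← mul_assoc, ha, mul_assoc]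
    · rw [Commute.mul_pow (ha b), ha2, hb2, one_mul]
  simp only [dif_pos hab, dif_pos (And.intro ha ha2), dif_pos (And.intro hb hb2)]
  have e1 := (hm _ hab).choose_spec
  have e2 := (hm _ ⟨ha, ha2⟩).choose_spec
  have e3 := (hm _ ⟨hb, hb2⟩).choose_spec
  constructor
  · rw [← hj]
    congr 1
    apply Subtype.ext
    rw [e1]
    change a * b = _ * _
    rw [e2, e3]
  · intro h
    rw [← e2, ← e3, hi h]
section expfour
variable {G : Type u} [Group G]

/-- The subgroup generated by the elements of order greater than two. -/
theorem lemma_B (hna : ∃ a b : G, a * b ≠ b * a)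
    (hB : Subgroup.closure {g : G | g ^ 2 ≠ 1} ≠ ⊤) :
    ∃ H : Subgroup G, H.Characteristic ∧ H.index = 2 := by
  set B := Subgroup.closure {g : G | g ^ 2 ≠ 1} with hBdef
  have hout : ∀ g, g ∉ B → g * g = 1 := by
    intro g hg
    by_contra hc
    rw [← pow_two] at hc
    exact hg (Subgroup.subset_closure hc)
  refine char_of_pred (fun g => g ∈ B) ?_ (fun g h => mul_mem) ?_ ?_
  · intro f g hg
    have h1 : B.map f.toMonoidHom ≤ B := by
      rw [hBdef, MonoidHom.map_closure]
      apply Subgroup.closure_mono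
      rintro _ ⟨x, hx, rfl⟩
      intro hc
      apply hx
      have : f (x ^ 2) = f 1 := by rw [map_pow, map_one]; exact hc
      exact f.injective this
    exact h1 ⟨g, hg, rfl⟩
  · intro s t hs ht
    by_contra hst
    have hs2 := hout _ hs
    have ht2 := hout _ ht
    have hst2 := hout _ hst
    have hall : ∀ g : G, g * g = 1 := by
      intro g
      by_cases hg : g ∈ B
      · have e1 := hout (s * g) (fun h => hs (by simpa using mul_mem h (inv_mem hg)))
        have e2 := hout (t * g) (fun h => ht (by simpa using mul_mem h (inv_mem hg)))
        have e3 := hout (s * t * g) (fun h => hst (by simpa using mul_mem h (inv_mem hg)))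
        have f1 : s * g * s = g⁻¹ := eq_inv_of_mul_eq_one_left (by rw [← e1]; group)
        have f2 : t * g * t = g⁻¹ := eq_inv_of_mul_eq_one_left (by rw [← e2]; group)
        have f3 : s * t * g * (s * t) = g⁻¹ := eq_inv_of_mul_eq_one_left (by rw [← e3]; group)
        have f4 : s * t = t * s := by
          have hs' : s⁻¹ = s := inv_eq_of_mul_eq_one_left hs2
          have ht' : t⁻¹ = t := inv_eq_of_mul_eq_one_left ht2
          have hst' : (s * t)⁻¹ = s * t := inv_eq_of_mul_eq_one_left hst2
          rw [← hst', mul_inv_rev, hs', ht']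
        have f5 : s * t * g * (s * t) = g := by
          calc s * t * g * (s * t) = s * (t * g * t) * s := by
                rw [f4]; nth_rw 1 [← f4]; group
            _ = (s * g * s)⁻¹ := by
                have hs' : s⁻¹ = s := inv_eq_of_mul_eq_one_left hs2
                rw [f2, mul_inv_rev, mul_inv_rev, hs']; group
            _ = g := by rw [f1, inv_inv]
        rw [f5] at f3
        nth_rw 1 [f3]; group
      · exact hout g hg
    obtain ⟨a, b, hab⟩ := hna
    apply hab
    have i : ∀ g : G, g⁻¹ = g := fun g => inv_eq_of_mul_eq_one_left (hall g)
    rw [← i (a * b), mul_inv_rev, i, i]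
  · by_contra hc
    push Not at hc
    exact hB (eq_top_iff.2 fun g _ => hc g)

/-- The subgroup generated by involutions. -/
theorem lemma_E (hna : ∃ a b : G, a * b ≠ b * a) (h4 : ∀ x : G, x ^ 4 = 1)
    (hk : ∀ x y : G, x * y = y * x ∨ x ^ 2 = 1 ∨ y ^ 2 = 1 ∨ (x * y) ^ 2 = 1)
    (hE : Subgroup.closure {g : G | g ^ 2 = 1} ≠ ⊤) :
    ∃ H : Subgroup G, H.Characteristic ∧ H.index = 2 := by
  set E := Subgroup.closure {g : G | g ^ 2 = 1} with hEdef
  have hin : ∀ g, g ^ 2 = 1 → g ∈ E := fun g hg => Subgroup.subset_closure hg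
  have hsqE : ∀ g, g ^ 2 ∈ E := fun g => hin _ (by rw [← pow_mul]; exact h4 g)
  have hcomm : ∀ x y, x ∉ E → y ∉ E → x * y ∉ E → x * y = y * x := by
    intro x y hx hy hxy
    rcases hk x y with h | h | h | h
    · exact h
    · exact absurd (hin _ h) hx
    · exact absurd (hin _ h) hy
    · exact absurd (hin _ h) hxy
  refine char_of_pred (fun g => g ∈ E) ?_ (fun g h => mul_mem) ?_ ?_
  · intro f g hg
    have h1 : E.map f.toMonoidHom ≤ E := by
      rw [hEdef, MonoidHom.map_closure]
      apply Subgroup.closure_mono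
      rintro _ ⟨x, hx, rfl⟩
      change (f x) ^ 2 = 1
      rw [← map_pow, show x ^ 2 = 1 from hx, map_one]
    exact h1 ⟨g, hg, rfl⟩
  · intro y z hy hz
    by_contra hyz
    have key2 : ∀ g, g ∉ E → ∃ w, w ∉ E ∧ g * w ∉ E := by
      intro g hg
      by_cases h1 : g * y ∈ E
      · refine ⟨z, hz, fun h2 => hyz ?_⟩
        have := mul_mem (hsqE y) (mul_mem (inv_mem h1) h2)
        have e : y ^ 2 * ((g * y)⁻¹ * (g * z)) = y * z := by rw [pow_two]; group
        rwa [e] at this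
      · exact ⟨y, hy, h1⟩
    have hcE : ∀ g e, g ∉ E → e ∈ E → g * e = e * g := by
      intro g e hg he
      obtain ⟨w, hw, hgw⟩ := key2 g hg
      have h1 := hcomm g w hg hw hgw
      have h2 := hcomm g (w * e) hg (fun h => hw (by simpa using mul_mem h (inv_mem he)))
        (fun h => hgw (by rw [← mul_assoc] at h; simpa using mul_mem h (inv_mem he)))
      have h3 : w * (g * e) = w * (e * g) := by
        rw [← mul_assoc, ← h1, mul_assoc, h2, mul_assoc]
      exact mul_left_cancel h3
    have hE1 : ∀ g h, g ∈ E → g * h = h * g := by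
      intro g h hg
      by_cases hh : h ∈ E
      · have hn : h * y⁻¹ ∉ E := by
          intro hc
          exact hy (inv_inv y ▸ inv_mem (by simpa using mul_mem (inv_mem hh) hc))
        have e1 := hcE _ g hn hg
        have e2 := hcE _ g hy hg
        calc g * h = g * (h * y⁻¹) * y := by group
          _ = h * y⁻¹ * (g * y) := by rw [← e1]; group
          _ = h * g := by rw [← e2]; group
      · exact (hcE h g hh hg).symm
    obtain ⟨a, b, hab⟩ := hna
    apply hab
    by_cases ha : a ∈ E
    · exact hE1 a b ha
    by_cases hb : b ∈ E
    · exact (hE1 b a hb).symm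
    by_cases hc : a * b ∈ E
    · have := hE1 _ a hc
      rw [mul_assoc] at this
      exact (mul_left_cancel this).symm
    · exact hcomm a b ha hb hc
  · by_contra hc
    push Not at hc
    exact hE (eq_top_iff.2 fun g _ => hc g)

/-- If an elementary abelian-like subgroup of index two exists, we are done. -/
theorem lemma_S (hna : ∃ a b : G, a * b ≠ b * a) (S : Subgroup G) (hS : S.index = 2)
    (hS2 : ∀ g ∈ S, g ^ 2 = 1) :
    ∃ H : Subgroup G, H.Characteristic ∧ H.index = 2 := by
  by_cases hch : S.Characteristic
  · exact ⟨S, hch, hS⟩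
  · rw [Subgroup.characteristic_iff_comap_eq] at hch
    push Not at hch
    obtain ⟨f, hf⟩ := hch
    set S' := S.comap f.toMonoidHom with hS'def
    have hS' : S'.index = 2 := by
      rw [hS'def, Subgroup.index_comap_of_surjective _ f.surjective, hS]
    have hS'2 : ∀ g ∈ S', g ^ 2 = 1 := by
      intro g hg
      have : f (g ^ 2) = f 1 := by rw [map_pow, map_one]; exact hS2 _ hg
      exact f.injective this
    let W : Subgroup G :=
      { carrier := {g | g ∈ S ↔ g ∈ S'}
        mul_mem' := by
          intro a b ha hb
          change (a ∈ S ↔ a ∈ S') at ha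
          change (b ∈ S ↔ b ∈ S') at hb
          change (a * b ∈ S ↔ a * b ∈ S')
          rw [Subgroup.mul_mem_iff_of_index_two hS, Subgroup.mul_mem_iff_of_index_two hS', ha, hb]
        one_mem' := by
          change (1 ∈ S ↔ 1 ∈ S')
          simp [one_mem]
        inv_mem' := by
          intro a ha
          change (a⁻¹ ∈ S ↔ a⁻¹ ∈ S')
          rw [inv_mem_iff, inv_mem_iff]
          exact ha }
    apply lemma_B hna
    intro htop
    apply hf
    have hle : Subgroup.closure {g : G | g ^ 2 ≠ 1} ≤ W := by
      rw [Subgroup.closure_le]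
      intro g hg
      change (g ∈ S ↔ g ∈ S')
      have h1 : g ∉ S := fun h => hg (hS2 _ h)
      have h2 : g ∉ S' := fun h => hg (hS'2 _ h)
      tauto
    rw [htop] at hle
    ext g
    exact (hle (Subgroup.mem_top g)).symm

theorem exp_four_core {R : Type u} [CommRing R] (h2 : (2 : R) = 0) (q : G → R) (b : G → G → R)
    (hq : ∀ g h, q (g * h) = q g + q h + b g h)
    (hbl : ∀ g h k, b (g * h) k = b g k + b h k)
    (hbs : ∀ g h, b g h = b h g) (hbb : ∀ g, b g g = 0)
    (hk : ∀ g h, b g h = 0 ∨ q g = 0 ∨ q h = 0 ∨ q (g * h) = 0)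
    (s t : G) (hs : q s = 0) (ht : q t = 0) (hc : b s t ≠ 0) :
    (∀ v, (b v s = 0 → q v = 0) ∧ (b v t = 0 → q v = 0) ∧ (b v s = b v t → q v = b v s)) ∧
    ((∀ v, b v s = 0 ∨ b v s = b s t) ∨ (∀ v, b v t = 0 ∨ b v t = b s t) ∨
      (∀ v, b v s + b v t = 0 ∨ b v s + b v t = b s t)) := by
  have hbr : ∀ g h k, b g (h * k) = b g h + b g k := by
    intro g h k
    rw [hbs, hbl, hbs h, hbs k]
  have hts : b t s = b s t := hbs t s
  have hss := hbb s
  have htt := hbb t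
  have hqx : q (s * t) = b s t := by rw [hq, hs, ht]; ring
  have I1 : ∀ v, b v s + b v t = 0 ∨ q v = 0 ∨ q v + b s t + b v s + b v t = 0 := by
    intro v
    have := hk v (s * t)
    rw [hq v, hqx, hbr] at this
    grind
  have I2 : ∀ v, b v s + b v t + b s t = 0 ∨ q v + b v s = 0 ∨ q v + b v t = 0 := by
    intro v
    have := hk (v * s) (s * t)
    rw [hq (v * s), hqx, hq v, hbl, hbr, hbr, hss, hs] at this
    grind
  have F : ∀ v, (b v s = 0 → q v = 0) ∧ (b v t = 0 → q v = 0) ∧ (b v s = b v t → q v = b v s) := by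
    intro v
    have h1 := I1 v
    have h2 := I2 v
    generalize b v s = α at *
    generalize b v t = β at *
    generalize q v = f at *
    generalize b s t = c at *
    clear hk hq hbl hbs hbb hbr I1 I2
    grind
  have T : ∀ v, (b v s = 0 ∨ b v s = b s t) ∨ (b v t = 0 ∨ b v t = b s t) ∨
      (b v s + b v t = 0 ∨ b v s + b v t = b s t) := by
    intro v
    have h1 := I1 v
    have h2 := I2 v
    generalize b v s = α at *
    generalize b v t = β at *
    generalize q v = f at *
    generalize b s t = c at *
    clear hk hq hbl hbs hbb hbr I1 I2 F
    grind
  refine ⟨F, ?_⟩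
  by_contra hcon
  push Not at hcon
  obtain ⟨⟨g1, h1, h1'⟩, ⟨g2, h2', h2''⟩, ⟨g3, h3, h3'⟩⟩ := hcon
  have hu : ∃ u, (b u s ≠ 0 ∧ b u s ≠ b s t) ∧ (b u t ≠ 0 ∧ b u t ≠ b s t) := by
    by_cases k1 : b g1 t ≠ 0 ∧ b g1 t ≠ b s t
    · exact ⟨g1, ⟨h1, h1'⟩, k1⟩
    by_cases k2 : b g2 s ≠ 0 ∧ b g2 s ≠ b s t
    · exact ⟨g2, k2, ⟨h2', h2''⟩⟩
    refine ⟨g1 * g2, ?_⟩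
    rw [hbl, hbl]
    clear hk hq hbl hbs hbb hbr I1 I2 F T
    grind
  have hw : ∃ w, (b w t ≠ 0 ∧ b w t ≠ b s t) ∧ (b w s + b w t ≠ 0 ∧ b w s + b w t ≠ b s t) := by
    by_cases k1 : b g3 t ≠ 0 ∧ b g3 t ≠ b s t
    · exact ⟨g3, k1, ⟨h3, h3'⟩⟩
    by_cases k2 : b g2 s + b g2 t ≠ 0 ∧ b g2 s + b g2 t ≠ b s t
    · exact ⟨g2, ⟨h2', h2''⟩, k2⟩
    refine ⟨g3 * g2, ?_⟩
    rw [hbl, hbl]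
    clear hk hq hbl hbs hbb hbr I1 I2 F T
    grind
  have hu2 : ∃ u, b u s = b u t ∧ b u s ≠ 0 ∧ b u s ≠ b s t := by
    obtain ⟨u, k1, k2⟩ := hu
    have k3 := T u
    by_cases k4 : b u s + b u t = 0
    · refine ⟨u, ?_, k1⟩
      clear hk hq hbl hbs hbb hbr I1 I2 F T
      grind
    · refine ⟨u * s, ?_⟩
      rw [hbl, hbl]
      clear hk hq hbl hbs hbb hbr I1 I2 F T
      grind
  have hw2 : ∃ w, b w s = 0 ∧ b w t ≠ 0 ∧ b w t ≠ b s t := by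
    obtain ⟨u, k1, k2⟩ := hw
    have k3 := T u
    by_cases k4 : b u s = 0
    · exact ⟨u, k4, k1⟩
    · refine ⟨u * t, ?_⟩
      rw [hbl, hbl]
      clear hk hq hbl hbs hbb hbr I1 I2 F T
      grind
  obtain ⟨u, u1, u2, u3⟩ := hu2
  have hw3 : ∃ w, b w s = 0 ∧ b w t = b u s := by
    obtain ⟨w, w1, w2, w3⟩ := hw2
    have k3 := T (u * w)
    rw [hbl, hbl] at k3
    by_cases k4 : b w t = b u s
    · exact ⟨w, w1, k4⟩
    · refine ⟨w * s, ?_⟩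
      rw [hbl, hbl]
      clear hk hq hbl hbs hbb hbr I1 I2 F T
      grind
  obtain ⟨w, w1, w2⟩ := hw3
  have qu : q u = b u s := (F u).2.2 u1
  have qw : q w = 0 := (F w).1 w1
  have quw := (F (u * w)).2.1 (by rw [hbl, w2, ← u1]; grind)
  rw [hq, qu, qw] at quw
  have fin := hk u (w * (s * t))
  rw [hq u, hq w, hbr u, hbr u, hbr w, hqx, qu, qw, w1, w2, ← u1] at fin
  clear hk hq hbl hbs hbb hbr I1 I2 F T
  grind

theorem exp_four (hsq : ∀ a b : G, a ^ 2 * b = b * a ^ 2) (hqf : QuaternionFree G)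
    (hna : ∃ a b : G, a * b ≠ b * a) (h4 : ∀ x : G, x ^ 4 = 1) :
    ∃ H : Subgroup G, H.Characteristic ∧ H.index = 2 := by
  have hqq : ∀ x : G, (x ^ 2) ^ 2 = 1 := fun x => by rw [← pow_mul]; exact h4 x
  have hk : ∀ x y : G, x * y = y * x ∨ x ^ 2 = 1 ∨ y ^ 2 = 1 ∨ (x * y) ^ 2 = 1 := by
    intro x y
    rcases key hsq hqf x y with ⟨i, j, hij⟩ | ⟨i, j, hn, hij⟩
    · left
      have hz : ∀ (x : G) (i : ℤ), x ^ (4 * i) = 1 := by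
        intro x i
        rw [zpow_mul]
        have : x ^ (4 : ℤ) = 1 := by exact_mod_cast h4 x
        rw [this, one_zpow]
      rw [hz, hz, one_mul] at hij
      exact commutatorElement_eq_one_iff_mul_comm.1 hij
    · right
      have hz : ∀ (x : G) (i : ℤ), (x ^ i) ^ 2 = (x ^ 2) ^ i := by
        intro x i
        rw [← zpow_natCast, ← zpow_mul, ← zpow_natCast x, ← zpow_mul, mul_comm]
      rw [mul_sq hsq, comm_zpow hsq, hz, hz] at hij
      have hc := comm_sq hsq x y
      rcases Int.even_or_odd i with hi | hi <;> rcases Int.even_or_odd j with hj | hj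
      · exact absurd ⟨hi, hj⟩ hn
      · rw [(zpow_sq_one (hqq x) i).1 hi, (zpow_sq_one (hqq y) j).2 hj,
          (zpow_sq_one hc _).1 (hi.mul_right _)] at hij
        right; left; simpa using hij
      · rw [(zpow_sq_one (hqq x) i).2 hi, (zpow_sq_one (hqq y) j).1 hj,
          (zpow_sq_one hc _).1 (hj.mul_left _)] at hij
        left; simpa using hij
      · rw [(zpow_sq_one (hqq x) i).2 hi, (zpow_sq_one (hqq y) j).2 hj,
          (zpow_sq_one hc _).2 (hi.mul hj)] at hij
        right; right; rw [mul_sq hsq]; exact hij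
  by_cases hE : Subgroup.closure {g : G | g ^ 2 = 1} = ⊤
  swap
  · exact lemma_E hna h4 hk hE
  have hst : ∃ s t : G, s ^ 2 = 1 ∧ t ^ 2 = 1 ∧ s * t ≠ t * s := by
    by_contra hcon
    push Not at hcon
    obtain ⟨a, b, hab⟩ := hna
    apply hab
    have ha : a ∈ Subgroup.closure {g : G | g ^ 2 = 1} := hE ▸ Subgroup.mem_top a
    have hb : b ∈ Subgroup.closure {g : G | g ^ 2 = 1} := hE ▸ Subgroup.mem_top b
    have hcl := Subgroup.isMulCommutative_closure (k := {g : G | g ^ 2 = 1})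
      (fun x hx y hy => hcon x y hx hy)
    exact congrArg Subtype.val
      (hcl.is_comm.comm (⟨a, ha⟩ : Subgroup.closure {g : G | g ^ 2 = 1}) ⟨b, hb⟩)
  obtain ⟨s, t, hs, ht, hst⟩ := hst
  obtain ⟨R, _, j, h2, hj⟩ := exists_j G
  have hcc := fun x y => comm_central hsq (G := G) x y
  have hc2 := fun x y => comm_sq hsq (G := G) x y
  have j1 : j 1 = 0 := by
    have := (hj 1 1 (by simp) (by simp) (by simp) (by simp)).1
    rw [mul_one] at this
    grind
  have hb0 : ∀ x y, j ⁅x, y⁆ = 0 ↔ x * y = y * x := by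
    intro x y
    rw [← j1, ← commutatorElement_eq_one_iff_mul_comm]
    exact ⟨(hj _ _ (hcc x y) (hc2 x y) (by simp) (by simp)).2, fun h => by rw [h]⟩
  have hq0 : ∀ x, j (x ^ 2) = 0 ↔ x ^ 2 = 1 := by
    intro x
    constructor
    · rw [← j1]
      exact (hj _ _ (hsq x) (hqq x) (by simp) (by simp)).2
    · intro h; rw [h, j1]
  have hbl : ∀ g h k : G, j ⁅g * h, k⁆ = j ⁅g, k⁆ + j ⁅h, k⁆ := by
    intro g h k
    rw [comm_mul_left hsq, (hj _ _ (hcc _ _) (hc2 _ _) (hcc _ _) (hc2 _ _)).1]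
  have hbb : ∀ g : G, j ⁅g, g⁆ = 0 := fun g => (hb0 g g).2 rfl
  have hsne : j ⁅s, t⁆ ≠ 0 := by rw [Ne, hb0]; exact hst
  obtain ⟨F, C⟩ := exp_four_core h2 (fun x => j (x ^ 2)) (fun x y => j ⁅x, y⁆) (by
      intro g h
      rw [mul_sq hsq, (hj _ _ ?_ ?_ (hcc _ _) (hc2 _ _)).1,
        (hj _ _ (hsq _) (hqq _) (hsq _) (hqq _)).1]
      · intro z
        rw [mul_assoc, hsq h z, ← mul_assoc, hsq g z, mul_assoc]
      · rw [Commute.mul_pow (hsq _ _), hqq, hqq, one_mul])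
    hbl (fun g h => by rw [comm_symm hsq]) hbb
    (fun g h => by
      rw [hb0, hq0, hq0, hq0]
      exact hk g h) s t ((hq0 s).2 hs) ((hq0 t).2 ht) hsne
  have main : ∀ s t : G, j ⁅s, t⁆ ≠ 0 → (∀ v : G, j ⁅v, s⁆ = 0 → j (v ^ 2) = 0) →
      (∀ v : G, j ⁅v, s⁆ = 0 ∨ j ⁅v, s⁆ = j ⁅s, t⁆) →
      ∃ H : Subgroup G, H.Characteristic ∧ H.index = 2 := by
    intro s t hst hF hC
    let f : G →* Multiplicative R := MonoidHom.mk' (fun v => Multiplicative.ofAdd (j ⁅v, s⁆))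
      (fun a b => by rw [hbl]; rfl)
    have hf : ∀ v, v ∈ f.ker ↔ j ⁅v, s⁆ = 0 := fun v => Iff.rfl
    apply lemma_S hna f.ker
    · rw [Subgroup.index_eq_two_iff]
      refine ⟨t, fun v => ?_⟩
      rw [hf, hf, hbl, comm_symm hsq t s]
      rcases hC v with h | h
      · right
        refine ⟨h, ?_⟩
        rw [h, zero_add]; exact hst
      · left
        rw [h]
        refine ⟨by grind, hst⟩
    · intro g hg
      exact (hq0 g).1 (hF g ((hf g).1 hg))
  rcases C with C | C | C
  · exact main s t hsne (fun v => (F v).1) C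
  · exact main t s (by rw [comm_symm hsq]; exact hsne) (fun v => (F v).2.1)
      (by rw [comm_symm hsq t s]; exact C)
  · apply lemma_B hna
    intro htop
    let f : G →* Multiplicative R :=
      MonoidHom.mk' (fun v => Multiplicative.ofAdd (j ⁅v, s⁆ + j ⁅v, t⁆))
      (fun a b => by
        rw [hbl, hbl, ← ofAdd_add]
        congr 1; ring)
    have hf : ∀ v, v ∈ f.ker ↔ j ⁅v, s⁆ + j ⁅v, t⁆ = 0 := fun v => Iff.rfl
    have hle : Subgroup.closure {g : G | g ^ 2 ≠ 1} ≤ f.ker := by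
      rw [Subgroup.closure_le]
      intro v hv
      rw [SetLike.mem_coe, hf]
      rcases C v with h | h
      · exact h
      · exfalso
        apply hv
        have e1 := (F (v * s)).2.2
        rw [hbl, hbl, hbb s, mul_sq hsq, hs, mul_one,
          (hj _ _ (hsq _) (hqq _) (hcc _ _) (hc2 _ _)).1] at e1
        rw [← hq0]
        have e2 := e1 (by linear_combination h - j ⁅v, t⁆ * h2)
        linear_combination e2
    rw [htop] at hle
    have := (hf s).1 (hle (Subgroup.mem_top s))
    rw [hbb, zero_add] at this
    exact hsne this

end expfour
section expbig
variable {G : Type u} [Group G]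

theorem lin_core {R : Type u} [CommRing R] (h2 : (2 : R) = 0) (p : G → R) (b : G → G → R)
    (hp : ∀ g h, p (g * h) = p g + p h)
    (hbl : ∀ g h k, b (g * h) k = b g k + b h k)
    (hbs : ∀ g h, b g h = b h g) (hbb : ∀ g, b g g = 0)
    (H1 : ∀ x y, p x ≠ 0 → p y ≠ 0 → p x ≠ p y →
      b x y = 0 ∨ b x y = p x ∨ b x y = p y ∨ b x y = p x + p y)
    (H2 : ∀ x n, p x ≠ 0 → p n = 0 → b x n = 0 ∨ b x n = p x)
    (H0 : ∀ x, ∃ y, p y ≠ 0 ∧ p x ≠ p y) :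
    (∀ g h, (∀ y, b g y = 0 ∨ b g y = p g) → (∀ y, b h y = 0 ∨ b h y = p h) →
      (∀ y, b (g * h) y = 0 ∨ b (g * h) y = p (g * h))) ∧
    (∀ g h, ¬ (∀ y, b g y = 0 ∨ b g y = p g) → ¬ (∀ y, b h y = 0 ∨ b h y = p h) →
      (∀ y, b (g * h) y = 0 ∨ b (g * h) y = p (g * h))) ∧
    ((∀ g, ∀ y, b g y = 0 ∨ b g y = p g) → ∀ g h, b g h = 0) := by
  have hbr : ∀ g h k, b g (h * k) = b g h + b g k := by
    intro g h k
    rw [hbs, hbl, hbs h, hbs k]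
  -- elements of the kernel of `p` commute
  have H3 : ∀ n n', p n = 0 → p n' = 0 → b n n' = 0 := by
    intro n n' hn hn'
    obtain ⟨x, hx, -⟩ := H0 1
    obtain ⟨y, hy, hxy⟩ := H0 x
    have a1 := H2 x n hx hn
    have a2 := H2 (x * n') n (by rw [hp]; grind) hn
    have a3 := H2 y n hy hn
    have a4 := H2 (y * n') n (by rw [hp]; grind) hn
    rw [hbl, hp, hbs n'] at a2 a4
    clear hbl hbr hbb hbs H1 H2 H0
    grind
  have dich : ∀ g, (∀ y, b g y = 0 ∨ b g y = p g) ∨ (∀ y, b g y = p y ∨ b g y = p y + p g) := by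
    intro g
    by_contra hcon
    push Not at hcon
    obtain ⟨⟨z, hz1, hz2⟩, ⟨y, hy1, hy2⟩⟩ := hcon
    by_cases hg : p g = 0
    · have hy0 : p y ≠ 0 := fun h => hy1 (by rw [H3 g y hg h, h])
      have hz0 : p z ≠ 0 := fun h => hz1 (H3 g z hg h)
      have a1 := H2 y g hy0 hg
      have a2 := H2 z g hz0 hg
      rw [hbs] at a1 a2
      by_cases hyz : p y = p z
      · have a3 := H3 g (y * z) hg (by rw [hp]; grind)
        rw [hbr] at a3
        grind
      · have a3 := H2 (y * z) g (by rw [hp]; grind) hg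
        rw [hbs, hbr, hp] at a3
        grind
    · -- any element dependent on `g`
      have dep : ∀ y, (p y = 0 ∨ p y = p g) → b g y = 0 ∨ b g y = p g := by
        rintro y (h | h)
        · exact H2 g y hg h
        · have := H2 g (g * y) hg (by rw [hp]; grind)
          rw [hbr, hbb] at this
          grind
      have hy0 : ¬ (p y = 0 ∨ p y = p g) := by
        intro h
        have := dep y h
        grind
      have hz0 : ¬ (p z = 0 ∨ p z = p g) := by
        intro h
        have := dep z h
        grind
      have a1 := H1 g y hg (by grind) (by grind)
      have a2 := H1 g z hg (by grind) (by grind)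
      by_cases hyz : p (y * z) = 0 ∨ p (y * z) = p g
      · have a3 := dep _ hyz
        rw [hbr] at a3
        rw [hp] at hyz
        clear hbl hbr hbb hbs H1 H2 H0 H3 dep
        grind
      · have a3 := H1 g (y * z) hg (by grind) (by grind)
        rw [hbr, hp] at a3
        rw [hp] at hyz
        clear hbl hbr hbb hbs H1 H2 H0 H3 dep
        grind
  -- additivity
  have add : ∀ g h, ((∀ y, b g y = 0 ∨ b g y = p g) ↔ (∀ y, b h y = 0 ∨ b h y = p h)) →
      ¬ (∀ y, b (g * h) y = p y ∨ b (g * h) y = p y + p (g * h)) := by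
    intro g h hgh hc
    by_cases hind : p g ≠ 0 ∧ p h ≠ 0 ∧ p g ≠ p h
    · have c1 := hc g
      have c2 := hc h
      rw [hbl, hp, hbb, hbs h g] at c1
      rw [hbl, hp, hbb] at c2
      by_cases hg : (∀ y, b g y = 0 ∨ b g y = p g)
      · have a1 := hg h
        have a2 := hgh.1 hg g
        rw [hbs] at a2
        clear hbl hbr hbb hbs H1 H2 H0 H3 dich
        grind
      · have hg' := (dich g).resolve_left hg h
        have hh' := (dich h).resolve_left (fun hh => hg (hgh.2 hh)) g
        rw [hbs] at hh'
        clear hbl hbr hbb hbs H1 H2 H0 H3 dich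
        grind
    · obtain ⟨y, hy0, hyg, hyh⟩ : ∃ y, p y ≠ 0 ∧ p y ≠ p g ∧ p y ≠ p h := by
        by_cases hg : p g = 0
        · obtain ⟨y, h1, h2⟩ := H0 h
          exact ⟨y, h1, by grind, by grind⟩
        · obtain ⟨y, h1, h2⟩ := H0 g
          exact ⟨y, h1, by grind, by grind⟩
      have c1 := hc y
      rw [hbl, hp] at c1
      by_cases hg : (∀ y, b g y = 0 ∨ b g y = p g)
      · have a1 := hg y
        have a2 := hgh.1 hg y
        clear hbl hbr hbb hbs H1 H2 H0 H3 dich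
        grind
      · have hg' := (dich g).resolve_left hg y
        have hh' := (dich h).resolve_left (fun hh => hg (hgh.2 hh)) y
        clear hbl hbr hbb hbs H1 H2 H0 H3 dich
        grind
  refine ⟨fun g h hg hh => (dich _).resolve_right (add g h (iff_of_true hg hh)),
    fun g h hg hh => (dich _).resolve_right (add g h (iff_of_false hg hh)), ?_⟩
  intro hall g h
  have a1 := hall g h
  have a2 := hall h g
  have a3 := hall g (g * h)
  have a4 := hall (g * h) g
  have a5 := hall (g * h) h
  rw [hbl, hp, hbb] at a4 a5
  rw [hbs] at a2 a4
  by_cases hg : p g = 0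
  · grind
  · by_cases hh : p h = 0
    · grind
    · grind

theorem exp_big (hsq : ∀ a b : G, a ^ 2 * b = b * a ^ 2) (hqf : QuaternionFree G)
    (hna : ∃ a b : G, a * b ≠ b * a) (m : ℕ) (hm : 2 ≤ m) (he : ∀ x : G, x ^ 2 ^ (m + 1) = 1)
    (hex : ∃ x : G, x ^ 2 ^ m ≠ 1) :
    ∃ H : Subgroup G, H.Characteristic ∧ H.index = 2 := by
  have hpm : ∀ x y : G, (x * y) ^ 2 ^ m = x ^ 2 ^ m * y ^ 2 ^ m :=
    fun x y => mul_pow_four hsq x y m hm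
  have hp2 : ∀ x : G, (x ^ 2 ^ m) ^ 2 = 1 := fun x => by rw [← pow_mul, ← pow_succ]; exact he x
  have hpow : ∀ (k : ℕ), 1 ≤ k → ∀ x z : G, x ^ 2 ^ k * z = z * x ^ 2 ^ k := by
    intro k hk x z
    obtain ⟨l, rfl⟩ := Nat.exists_eq_add_of_le hk
    rw [add_comm, pow_succ, pow_mul, hsq]
  have hpc := hpow m (by omega)
  have hpz : ∀ (x : G) (i : ℤ), (x ^ i) ^ 2 ^ m = (x ^ 2 ^ m) ^ i := by
    intro x i
    rw [← zpow_natCast, ← zpow_mul, ← zpow_natCast x, ← zpow_mul, mul_comm]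
  by_cases H0 : ∀ x : G, ∃ y : G, y ^ 2 ^ m ≠ 1 ∧ x ^ 2 ^ m ≠ y ^ 2 ^ m
  swap
  · -- the kernel of the power map has index two
    push Not at H0
    obtain ⟨x, hx⟩ := H0
    refine char_of_pred (fun g => g ^ 2 ^ m = 1) ?_ ?_ ?_ hex
    · intro f g hg
      rw [← map_pow, hg, map_one]
    · intro g h hg hh
      rw [hpm, hg, hh, one_mul]
    · intro g h hg hh
      rw [hpm, ← hx g hg, ← hx h hh, ← pow_two, hp2]
  have hcc := fun x y => comm_central hsq (G := G) x y
  have hc2 := fun x y => comm_sq hsq (G := G) x y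
  -- independent pairs
  have K1 : ∀ x y : G, x ^ 2 ^ m ≠ 1 → y ^ 2 ^ m ≠ 1 → x ^ 2 ^ m ≠ y ^ 2 ^ m →
      ⁅x, y⁆ = 1 ∨ ⁅x, y⁆ = x ^ 2 ^ m ∨ ⁅x, y⁆ = y ^ 2 ^ m ∨ ⁅x, y⁆ = x ^ 2 ^ m * y ^ 2 ^ m := by
    intro x y hx hy hxy
    rcases key hsq hqf x y with ⟨i, j, hij⟩ | ⟨i, j, hn, hij⟩
    · have h1 := hc2 x y
      rw [hij] at h1
      obtain ⟨h3, h4⟩ := disj' hsq m m x y (he x) (he y) hx hy hxy (4 * i) (4 * j)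
        ⟨2 * i, by ring⟩ h1
      rw [hij]
      rcases h3 with h3 | h3 <;> rcases h4 with h4 | h4 <;> rw [h3, h4] <;> simp
    · exfalso
      have h1 : (x ^ i * y ^ j) ^ 2 ^ m = 1 := by
        obtain ⟨l, rfl⟩ := Nat.exists_eq_add_of_le hm
        rw [add_comm, pow_add, mul_comm, pow_mul, show (2 : ℕ) ^ 2 = 2 * 2 from rfl, pow_mul, hij,
          one_pow, one_pow]
      rw [hpm, hpz, hpz] at h1
      rcases Int.even_or_odd i with hi | hi <;> rcases Int.even_or_odd j with hj | hj
      · exact hn ⟨hi, hj⟩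
      · rw [(zpow_sq_one (hp2 x) i).1 hi, (zpow_sq_one (hp2 y) j).2 hj, one_mul] at h1
        exact hy h1
      · rw [(zpow_sq_one (hp2 x) i).2 hi, (zpow_sq_one (hp2 y) j).1 hj, mul_one] at h1
        exact hx h1
      · rw [(zpow_sq_one (hp2 x) i).2 hi, (zpow_sq_one (hp2 y) j).2 hj] at h1
        apply hxy
        rw [eq_inv_of_mul_eq_one_left h1]
        apply inv_eq_of_mul_eq_one_left
        rw [← pow_two, hp2]
  -- commutators with kernel elements are values of the power map
  have K2 : ∀ x n : G, x ^ 2 ^ m ≠ 1 → n ^ 2 ^ m = 1 → ∃ g : G, ⁅x, n⁆ = g ^ 2 ^ m := by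
    intro x n hx hn
    obtain ⟨y, hy, hxy⟩ := H0 x
    have val : ∀ y : G, y ^ 2 ^ m ≠ 1 → x ^ 2 ^ m ≠ y ^ 2 ^ m → ∃ g : G, ⁅x, y⁆ = g ^ 2 ^ m := by
      intro y hy hxy
      rcases K1 x y hx hy hxy with h | h | h | h
      · exact ⟨1, by rw [h, one_pow]⟩
      · exact ⟨x, h⟩
      · exact ⟨y, h⟩
      · exact ⟨x * y, by rw [h, hpm]⟩
    have hyn : (y * n) ^ 2 ^ m = y ^ 2 ^ m := by rw [hpm, hn, mul_one]
    obtain ⟨g, hg⟩ := val y hy hxy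
    obtain ⟨g', hg'⟩ := val (y * n) (by rw [hyn]; exact hy) (by rw [hyn]; exact hxy)
    refine ⟨g * g', ?_⟩
    rw [hpm, ← hg, ← hg', comm_mul_right hsq, ← mul_assoc, ← pow_two, hc2, one_mul]
  have evn : ∀ (x n : G) (i j : ℤ), x ^ 2 ^ m ≠ 1 → n ^ 2 ^ m = 1 → ¬ (Even i ∧ Even j) →
      (x ^ i * n ^ j) ^ 2 = 1 → Odd j ∧ (n ^ 2) ^ j ∈ Subgroup.zpowers x := by
    intro x n i j hx hn hnot hij
    have h1 : (x ^ i * n ^ j) ^ 2 ^ m = 1 := by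
      obtain ⟨l, rfl⟩ := Nat.exists_eq_add_of_le hm
      rw [add_comm, pow_add, mul_comm, pow_mul, show (2 : ℕ) ^ 2 = 2 * 2 from rfl, pow_mul, hij,
        one_pow, one_pow]
    rw [hpm, hpz, hpz, hn, one_zpow, mul_one] at h1
    have hi : Even i := by
      by_contra hi
      rw [(zpow_sq_one (hp2 x) i).2 (Int.not_even_iff_odd.1 hi)] at h1
      exact hx h1
    have hj : Odd j := by
      rw [← Int.not_even_iff_odd]
      exact fun hj => hnot ⟨hi, hj⟩
    refine ⟨hj, ?_⟩
    rw [Commute.mul_pow (even_central hsq _ _ _ hi)] at hij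
    have h3 : (n ^ 2) ^ j = (n ^ j) ^ 2 := by
      rw [← zpow_natCast, ← zpow_mul, ← zpow_natCast (n ^ j), ← zpow_mul, mul_comm]
    rw [h3, eq_inv_of_mul_eq_one_right hij]
    exact inv_mem (pow_mem (zpow_mem (Subgroup.mem_zpowers x) i) 2)
  have K3 : ∀ k : ℕ, k ≤ m → ∀ x n : G, x ^ 2 ^ m ≠ 1 → n ^ 2 ^ k = 1 →
      ⁅x, n⁆ = 1 ∨ ⁅x, n⁆ = x ^ 2 ^ m := by
    intro k
    induction k with
    | zero =>
      intro _ x n hx hn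
      left
      rw [pow_zero, pow_one] at hn
      rw [hn, commutatorElement_one_right]
    | succ k ih =>
      intro hkm x n hx hn
      have hN : n ^ 2 ^ m = 1 := by
        obtain ⟨l, hl⟩ := Nat.exists_eq_add_of_le hkm
        rw [hl, pow_add, pow_mul, hn, one_pow]
      rcases Nat.eq_zero_or_pos k with hk | hk
      · subst hk
        rw [zero_add, pow_one] at hn
        obtain ⟨y, hy, hxy⟩ := H0 x
        -- multiply `n` by a central element of order four
        obtain ⟨l, hl⟩ := Nat.exists_eq_add_of_le hm
        have hzc : ∀ z, y ^ 2 ^ (l + 1) * z = z * y ^ 2 ^ (l + 1) := hpow _ (by omega) y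
        have hzz : (y ^ 2 ^ (l + 1)) ^ 2 = y ^ 2 ^ m := by
          rw [← pow_mul, ← pow_succ, hl]; congr 2; ring
        set z := y ^ 2 ^ (l + 1) with hz
        have hn2 : (n * z) ^ 2 = y ^ 2 ^ m := by
          rw [Commute.mul_pow (hzc n).symm, hn, one_mul, hzz]
        have hn4 : (n * z) ^ (4 : ℤ) = 1 := by
          have : (n * z) ^ 4 = 1 := by
            rw [show 4 = 2 * 2 from rfl, pow_mul, hn2, hp2]
          exact_mod_cast this
        have hnm : (n * z) ^ 2 ^ m = 1 := by
          rw [hl, pow_add, pow_mul, show 2 ^ 2 = 2 * 2 from rfl, pow_mul, hn2, hp2, one_pow]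
        have hcz : ⁅x, n * z⁆ = ⁅x, n⁆ := by
          rw [comm_mul_right hsq, commutatorElement_eq_one_iff_mul_comm.2 (hzc x).symm, mul_one]
        rw [← hcz]
        rcases key hsq hqf x (n * z) with ⟨i, j, hij⟩ | ⟨i, j, hnot, hij⟩
        · apply cyc_two m x _ (he x) hx
          · rw [hij, zpow_mul (n * z), hn4, one_zpow, mul_one]
            exact ⟨_, rfl⟩
          · exact hc2 _ _
        · exfalso
          obtain ⟨hj, h1⟩ := evn x (n * z) i j hx hnm hnot hij
          rw [hn2, (zpow_sq_one (hp2 y) j).2 hj] at h1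
          rcases cyc_two m x _ (he x) hx h1 (hp2 y) with h | h
          · exact hy h
          · exact hxy h.symm
      · by_cases hw : n ^ 2 ^ k = 1
        · exact ih (by omega) x n hx hw
        by_cases hwv : ∃ y : G, n ^ 2 ^ k = y ^ 2 ^ m
        · obtain ⟨y, hy⟩ := hwv
          obtain ⟨l, hl⟩ := Nat.exists_eq_add_of_le hkm
          have hzc : ∀ z, y ^ 2 ^ (l + 1) * z = z * y ^ 2 ^ (l + 1) := hpow _ (by omega) y
          have hzz : (y ^ 2 ^ (l + 1)) ^ 2 ^ k = y ^ 2 ^ m := by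
            rw [← pow_mul, ← pow_add, hl]; congr 2; ring
          have hcz : ⁅x, n * y ^ 2 ^ (l + 1)⁆ = ⁅x, n⁆ := by
            rw [comm_mul_right hsq, commutatorElement_eq_one_iff_mul_comm.2 (hzc x).symm, mul_one]
          rw [← hcz]
          apply ih (by omega) x _ hx
          rw [Commute.mul_pow (hzc n).symm, hzz, hy, ← pow_two, hp2]
        · have hne : x ^ 2 ^ m ≠ n ^ 2 ^ k := fun h => hwv ⟨x, h.symm⟩
          have hw2 : (n ^ 2 ^ k) ^ 2 = 1 := by rw [← pow_mul, ← pow_succ]; exact hn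
          rcases key hsq hqf x n with ⟨i, j, hij⟩ | ⟨i, j, hnot, hij⟩
          · have h1 := hc2 x n
            rw [hij] at h1
            obtain ⟨h3, h4⟩ := disj' hsq m k x n (he x) hn hx hw hne (4 * i) (4 * j)
              ⟨2 * i, by ring⟩ h1
            obtain ⟨g, hg⟩ := K2 x n hx hN
            rw [hij] at hg ⊢
            rcases h4 with h4 | h4
            · rw [h4, mul_one]
              exact h3
            · exfalso
              apply hwv
              rw [h4] at hg
              rcases h3 with h3 | h3
              · rw [h3, one_mul] at hg
                exact ⟨g, hg⟩
              · rw [h3] at hg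
                refine ⟨x * g, ?_⟩
                rw [hpm, ← hg, ← mul_assoc, ← pow_two, hp2, one_mul]
          · exfalso
            obtain ⟨hj, h1⟩ := evn x n i j hx hN hnot hij
            obtain ⟨l, rfl⟩ := Nat.exists_eq_add_of_le hk
            have h2 : ((n ^ 2) ^ j) ^ 2 ^ l = n ^ 2 ^ (1 + l) := by
              rw [← (zpow_sq_one hw2 j).2 hj, pow_add, pow_mul, pow_one,
                ← zpow_natCast, ← zpow_mul, ← zpow_natCast (n ^ 2), ← zpow_mul, mul_comm]
            have h3 := pow_mem h1 (2 ^ l)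
            rw [h2] at h3
            rcases cyc_two m x _ (he x) hx h3 hw2 with h | h
            · exact hw h
            · exact hne h.symm
  obtain ⟨R, _, j, h2, hj⟩ := exists_j G
  have j1 : j 1 = 0 := by
    have := (hj 1 1 (by simp) (by simp) (by simp) (by simp)).1
    rw [mul_one] at this
    grind
  have inj_p : ∀ x y : G, j (x ^ 2 ^ m) = j (y ^ 2 ^ m) ↔ x ^ 2 ^ m = y ^ 2 ^ m := fun x y =>
    ⟨(hj _ _ (hpc x) (hp2 x) (hpc y) (hp2 y)).2, fun h => by rw [h]⟩
  have p0 : ∀ x : G, j (x ^ 2 ^ m) = 0 ↔ x ^ 2 ^ m = 1 := by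
    intro x
    have := inj_p x 1
    rwa [one_pow, j1] at this
  have c0 : ∀ x y : G, j ⁅x, y⁆ = 0 ↔ ⁅x, y⁆ = 1 := by
    intro x y
    rw [← j1]
    exact ⟨(hj _ _ (hcc x y) (hc2 x y) (by simp) (by simp)).2, fun h => by rw [h]⟩
  have cp : ∀ x y z : G, j ⁅x, y⁆ = j (z ^ 2 ^ m) ↔ ⁅x, y⁆ = z ^ 2 ^ m := by
    intro x y z
    exact ⟨(hj _ _ (hcc x y) (hc2 x y) (hpc z) (hp2 z)).2, fun h => by rw [h]⟩
  have padd : ∀ x y : G, j ((x * y) ^ 2 ^ m) = j (x ^ 2 ^ m) + j (y ^ 2 ^ m) := by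
    intro x y
    rw [hpm, (hj _ _ (hpc x) (hp2 x) (hpc y) (hp2 y)).1]
  obtain ⟨A1, A2, A3⟩ := lin_core h2 (fun x : G => j (x ^ 2 ^ m)) (fun x y => j ⁅x, y⁆) padd
    (fun g h k => by
      rw [comm_mul_left hsq, (hj _ _ (hcc _ _) (hc2 _ _) (hcc _ _) (hc2 _ _)).1])
    (fun g h => by rw [comm_symm hsq])
    (fun g => by rw [commutatorElement_self, j1])
    (fun x y hx hy hxy => by
      rw [Ne, p0] at hx hy
      rw [Ne, inj_p] at hxy
      rw [c0, cp, cp, ← padd, cp, hpm]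
      exact K1 x y hx hy hxy)
    (fun x n hx hn => by
      rw [Ne, p0] at hx
      rw [p0] at hn
      rw [c0, cp]
      exact K3 m le_rfl x n hx hn)
    (fun x => by
      obtain ⟨y, h1, h2⟩ := H0 x
      exact ⟨y, by rw [Ne, p0]; exact h1, by rw [Ne, inj_p]; exact h2⟩)
  simp only [c0, cp] at A1 A2 A3
  refine char_of_pred (fun g => ∀ y : G, ⁅g, y⁆ = 1 ∨ ⁅g, y⁆ = g ^ 2 ^ m) ?_ A1 A2 ?_
  · intro f g hg y
    have e : ⁅f g, y⁆ = f ⁅g, f.symm y⁆ := by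
      rw [map_commutatorElement, MulEquiv.apply_symm_apply]
    rw [e]
    rcases hg (f.symm y) with h | h
    · left; rw [h, map_one]
    · right; rw [h, map_pow]
  · by_contra hcon
    push Not at hcon
    obtain ⟨a, b, hab⟩ := hna
    exact hab (commutatorElement_eq_one_iff_mul_comm.1 (A3 hcon a b))

end expbig

section final
variable {G : Type u} [Group G]

theorem exists_exp [Finite G] (h2 : IsPGroup 2 G) : ∃ n : ℕ, ∀ x : G, x ^ 2 ^ n = 1 := by
  obtain ⟨n, hn⟩ := IsPGroup.iff_card.1 h2
  refine ⟨n, fun x => ?_⟩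
  rw [← hn]
  exact pow_card_eq_one'

theorem sq_central_case [Finite G] (h2 : IsPGroup 2 G) (hsq : ∀ a b : G, a ^ 2 * b = b * a ^ 2)
    (hqf : QuaternionFree G) (hna : ∃ a b : G, a * b ≠ b * a) :
    ∃ H : Subgroup G, H.Characteristic ∧ H.index = 2 := by
  classical
  by_cases h4 : ∀ x : G, x ^ 4 = 1
  · exact exp_four hsq hqf hna h4
  have hex := exists_exp h2
  have hs := Nat.find_spec hex
  have hmin : ∀ k, k < Nat.find hex → ¬ ∀ x : G, x ^ 2 ^ k = 1 := fun k hk => Nat.find_min hex hk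
  generalize Nat.find hex = e at hs hmin
  have he : 3 ≤ e := by
    by_contra hlt
    apply h4
    intro x
    have h : e ≤ 2 := by omega
    have hd : 2 ^ e ∣ 2 ^ 2 := pow_dvd_pow 2 h
    obtain ⟨k, hk⟩ := hd
    have : x ^ (2 ^ 2) = 1 := by rw [hk, pow_mul, hs, one_pow]
    exact this
  obtain ⟨m, rfl⟩ : ∃ m, e = m + 1 := ⟨e - 1, by omega⟩
  refine exp_big hsq hqf hna m (by omega) hs ?_
  have := hmin m (by omega)
  push Not at this
  exact this

theorem lift_char (K : Subgroup G) [hK : K.Characteristic]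
    (h : ∃ H : Subgroup (G ⧸ K), H.Characteristic ∧ H.index = 2) :
    ∃ H : Subgroup G, H.Characteristic ∧ H.index = 2 := by
  obtain ⟨H, hc, hi⟩ := h
  refine ⟨H.comap (QuotientGroup.mk' K), ?_, ?_⟩
  · constructor
    intro f
    have hm : K.map f.toMonoidHom = K := Subgroup.characteristic_iff_map_eq.1 hK f
    let F : G ⧸ K ≃* G ⧸ K := QuotientGroup.congr K K f hm
    have hF := hc.fixed F
    ext x
    have h1 : F (QuotientGroup.mk' K x) = QuotientGroup.mk' K (f x) := rfl
    have h2 : QuotientGroup.mk' K x ∈ H.comap F.toMonoidHom ↔ QuotientGroup.mk' K x ∈ H := by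
      rw [hF]
    rw [Subgroup.mem_comap, Subgroup.mem_comap, Subgroup.mem_comap]
    rw [← h2, Subgroup.mem_comap]
    exact Iff.of_eq (congrArg (· ∈ H) h1.symm)
  · rw [Subgroup.index_comap_of_surjective _ (QuotientGroup.mk'_surjective K), hi]

theorem quot_comm_iff (K : Subgroup G) [K.Normal] (a b : G) :
    (a : G ⧸ K) * b = b * a ↔ ⁅a, b⁆ ∈ K := by
  rw [← commutatorElement_eq_one_iff_mul_comm, ← QuotientGroup.eq_one_iff]
  exact Iff.rfl

theorem class_two_case [Finite G] (h2 : IsPGroup 2 G)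
    (hcc : ∀ a b z : G, ⁅a, b⁆ * z = z * ⁅a, b⁆)
    (hqf : QuaternionFree G) (hna : ∃ a b : G, a * b ≠ b * a) :
    ∃ H : Subgroup G, H.Characteristic ∧ H.index = 2 := by
  classical
  let S : Set G := {x | ∃ a b : G, x = ⁅a, b⁆ ^ 2}
  let K : Subgroup G := Subgroup.closure S
  have hK : K.Characteristic := by
    rw [Subgroup.characteristic_iff_map_le]
    intro f
    rw [MonoidHom.map_closure, Subgroup.closure_le]
    rintro _ ⟨_, ⟨a, b, rfl⟩, rfl⟩
    apply Subgroup.subset_closure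
    refine ⟨f a, f b, ?_⟩
    change f (⁅a, b⁆ ^ 2) = _
    rw [map_pow, map_commutatorElement]
  apply lift_char K
  apply sq_central_case (h2.to_quotient K) ?_ (qf_quotient hqf K) ?_
  · intro a b
    induction a using QuotientGroup.induction_on with | _ a => ?_
    induction b using QuotientGroup.induction_on with | _ b => ?_
    have : ((a ^ 2 : G) : G ⧸ K) * b = b * (a ^ 2 : G) := by
      rw [quot_comm_iff]
      have : ⁅a ^ 2, b⁆ = ⁅a, b⁆ ^ 2 := by
        have e : ⁅a ^ 2, b⁆ = a * ⁅a, b⁆ * a⁻¹ * ⁅a, b⁆ := by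
          simp only [commutatorElement_def, sq]; group
        rw [e, ← hcc a b a, sq]; group
      rw [this]
      exact Subgroup.subset_closure ⟨a, b, rfl⟩
    exact this
  · have hex : ∃ n : ℕ, ∀ a b : G, ⁅a, b⁆ ^ 2 ^ n = 1 := by
      obtain ⟨n, hn⟩ := exists_exp h2
      exact ⟨n, fun a b => hn _⟩
    have hs := Nat.find_spec hex
    have hmin : ∀ k, k < Nat.find hex → ¬ ∀ a b : G, ⁅a, b⁆ ^ 2 ^ k = 1 :=
      fun k hk => Nat.find_min hex hk
    generalize Nat.find hex = e at hs hmin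
    obtain _ | e := e
    · obtain ⟨a, b, hab⟩ := hna
      exfalso
      apply hab
      have := hs a b
      rw [pow_zero, pow_one] at this
      exact commutatorElement_eq_one_iff_mul_comm.1 this
    have := hmin e (by omega)
    push Not at this
    obtain ⟨a, b, hab⟩ := this
    refine ⟨(a : G ⧸ K), (b : G ⧸ K), ?_⟩
    rw [Ne, quot_comm_iff]
    intro hmem
    have hall : ∀ x ∈ K, (∀ z, x * z = z * x) ∧ x ^ 2 ^ e = 1 := by
      intro x hx
      induction hx using Subgroup.closure_induction with
      | mem x hx =>
        obtain ⟨a, b, rfl⟩ := hx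
        refine ⟨fun z => ?_, ?_⟩
        · have h : Commute ⁅a, b⁆ z := hcc a b z
          exact h.pow_left 2
        · rw [← pow_mul, ← pow_succ']; exact hs a b
      | one => simp
      | mul x y _ _ hx hy =>
        refine ⟨fun z => ?_, ?_⟩
        · rw [mul_assoc, hy.1 z, ← mul_assoc, hx.1 z, mul_assoc]
        · rw [Commute.mul_pow (hx.1 y), hx.2, hy.2, one_mul]
      | inv x _ hx =>
        refine ⟨fun z => ?_, by rw [inv_pow, hx.2, inv_one]⟩
        have : Commute x z := hx.1 z
        exact this.inv_left
    exact hab (hall _ hmem).2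

theorem general_case [Finite G] (h2 : IsPGroup 2 G)
    (hqf : QuaternionFree G) (hna : ∃ a b : G, a * b ≠ b * a) :
    ∃ H : Subgroup G, H.Characteristic ∧ H.index = 2 := by
  let K : Subgroup G := ⁅(⁅(⊤ : Subgroup G), (⊤ : Subgroup G)⁆), (⊤ : Subgroup G)⁆
  have hK : K.Characteristic := inferInstance
  apply lift_char K
  apply class_two_case (h2.to_quotient K) ?_ (qf_quotient hqf K) ?_
  · intro a b z
    induction a using QuotientGroup.induction_on with | _ a => ?_
    induction b using QuotientGroup.induction_on with | _ b => ?_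
    induction z using QuotientGroup.induction_on with | _ z => ?_
    have : ((⁅a, b⁆ : G) : G ⧸ K) * z = z * (⁅a, b⁆ : G) := by
      rw [quot_comm_iff]
      exact Subgroup.commutator_mem_commutator
        (Subgroup.commutator_mem_commutator (Subgroup.mem_top _) (Subgroup.mem_top _))
        (Subgroup.mem_top _)
    exact this
  · by_contra hcon
    push Not at hcon
    have hle : ⁅(⊤ : Subgroup G), (⊤ : Subgroup G)⁆ ≤ K := by
      rw [Subgroup.commutator_le]
      intro a _ b _
      exact (quot_comm_iff K a b).1 (hcon a b)
    have hall : ∀ n, ⁅(⊤ : Subgroup G), (⊤ : Subgroup G)⁆ ≤ Subgroup.lowerCentralSeries (⊤ : Subgroup G) n := by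
      intro n
      induction n with
      | zero => exact le_top
      | succ n ih => exact hle.trans (Subgroup.commutator_mono ih le_rfl)
    have := h2.isNilpotent
    obtain ⟨n, hn⟩ := Subgroup.nilpotent_iff_lowerCentralSeries.1 this
    have hb := hall n
    rw [hn] at hb
    obtain ⟨a, b, hab⟩ := hna
    have := hb (Subgroup.commutator_mem_commutator (Subgroup.mem_top a) (Subgroup.mem_top b))
    exact hab (commutatorElement_eq_one_iff_mul_comm.1 (Subgroup.mem_bot.1 this))

end final

end WardQF

theorem quaternion_free_char_index_two {G : Type*} [Group G] [Finite G]
    (h2 : IsPGroup 2 G) (hna : ∃ a b : G, a * b ≠ b * a)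
    (hqf : QuaternionFree G) :
    ∃ H : Subgroup G, H.Characteristic ∧ H.index = 2 :=
  WardQF.general_case h2 hqf hna
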